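/- Let α ∈ ℕ, ε > 0, let K satisfy Assumption K, and let (γ_n) be a positive sequence with γ_n → 0. (i) If μ ∈ R(x₀,β) with β > −1, then for n large enough P^n_μ(|K_{n,γ_n,α}/(nF_ν(γ_n)) − (β+1)K_{α,β}| > ε) ≤ 2exp(−(ε²/(8(2+ε/3))) nF_ν(γ_n)), where K_{α,β} = (1+(−1)^α)∫₀¹ y^{α+β}K(y)dy. (ii) If μ ∈ R(x₀,−1), then for n large enough P^n_μ(|K_{n,γ_n,0}/(nF_ν(γ_n)) − 2K(0)| > ε) ≤ 2exp(−(ε²/(8(2+ε/3))) nF_ν(γ_n)). -/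

import Mathlib

open MeasureTheory ProbabilityTheory Filter Set Matrix Asymptotics
open scoped ENNReal NNReal

noncomputable section

/-- A continuous positive function is regularly varying at `0` with index `β`. -/
def RegVaryAt0 (ν : ℝ → ℝ) (β : ℝ) : Prop :=
  (∀ h : ℝ, 0 < h → 0 < ν h) ∧ ContinuousOn ν (Set.Ioi 0) ∧
    ∀ y : ℝ, 0 < y →
      Filter.Tendsto (fun h => ν (y * h) / ν h) (nhdsWithin (0:ℝ) (Set.Ioi 0))
        (nhds (y ^ β))

/-- A non-decreasing continuous positive function is `Γ`-varying at `0` with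
continuous positive auxiliary function `ρ`. -/
def GammaVary (ν ρ : ℝ → ℝ) : Prop :=
  (∀ h : ℝ, 0 < h → 0 < ν h) ∧ (∀ h : ℝ, 0 < h → 0 < ρ h) ∧
    ContinuousOn ν (Set.Ioi 0) ∧ ContinuousOn ρ (Set.Ioi 0) ∧
    MonotoneOn ν (Set.Ioi 0) ∧
    ∀ y : ℝ, Filter.Tendsto (fun h => ν (h + y * ρ h) / ν h)
      (nhdsWithin (0:ℝ) (Set.Ioi 0)) (nhds (Real.exp y))

/-- `F_ν(h) = ∫_0^h ν(t) dt`. -/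
def Fnu (ν : ℝ → ℝ) (h : ℝ) : ℝ := ∫ t in (0:ℝ)..h, ν t

/-- `h` is the smallest (positive) solution of `ω(h) = σ / sqrt (2 n F_ν(h))`. -/
def IsSmallestBandwidth (ν ω : ℝ → ℝ) (σ : ℝ) (n : ℕ) (h : ℝ) : Prop :=
  0 < h ∧ ω h * Real.sqrt (2 * n * Fnu ν h) = σ ∧
    ∀ h' : ℝ, 0 < h' → ω h' * Real.sqrt (2 * n * Fnu ν h') = σ → h ≤ h'

/-- `k = ⌊s⌋`, the largest integer (strictly) smaller than `s` for integer `s`. -/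
def kdeg (s : ℝ) : ℕ := ⌈s⌉₊ - 1

/-- The local smoothness class `F_δ(x₀, ω)`: for every `h ≤ δ`, the best local
polynomial approximation of degree `≤ k` on `{|x - x₀| ≤ h}` is at most `ω(h)`. -/
def holderClass (x₀ : ℝ) (ω : ℝ → ℝ) (k : ℕ) (δ : ℝ) : Set (ℝ → ℝ) :=
  {f | ∀ h : ℝ, 0 < h → h ≤ δ → ∀ ε : ℝ, 0 < ε → ∃ P : Polynomial ℝ,
      P.natDegree ≤ k ∧ ∀ x ∈ Set.Icc (0:ℝ) 1, |x - x₀| ≤ h →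
        |f x - P.eval (x - x₀)| ≤ ω h + ε}

/-- `U(α)`, the sup-norm ball of radius `α` for functions on `[0,1]`. -/
def boundedClass (α : ℝ) : Set (ℝ → ℝ) := {f | ∀ x ∈ Set.Icc (0:ℝ) 1, |f x| ≤ α}

/-- `Σ_{δ,α}(x₀,ω) = F_δ(x₀,ω) ∩ U(α)`. -/
def sigmaClass (x₀ : ℝ) (ω : ℝ → ℝ) (k : ℕ) (δ α : ℝ) : Set (ℝ → ℝ) :=
  holderClass x₀ ω k δ ∩ boundedClass α

/-- The design distribution, with density `μdens` with respect to Lebesgue measure. -/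
def designMeasure (μdens : ℝ → ℝ) : Measure ℝ :=
  MeasureTheory.volume.withDensity fun x => ENNReal.ofReal (μdens x)

/-- Joint law `P^n_μ` of the design `X_1, …, X_n` (i.i.d. with density `μdens`). -/
def designLaw (μdens : ℝ → ℝ) (n : ℕ) : Measure (Fin n → ℝ) :=
  Measure.pi fun _ => designMeasure μdens

/-- Assumption M : near `x₀` the design density is `x ↦ ν |x - x₀|` with `ν`
continuous and positive. -/
def AssumptionM (μdens ν : ℝ → ℝ) (x₀ : ℝ) : Prop :=
  ContinuousOn ν (Set.Ioi 0) ∧ (∀ h : ℝ, 0 < h → 0 < ν h) ∧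
    ∃ W ∈ nhds x₀, ∀ x ∈ W, μdens x = ν |x - x₀|

/-- Law of the noise vector `(ξ_1, …, ξ_n)`, i.i.d. centered Gaussian with
variance `σ²`. -/
def noiseLaw (σ : ℝ) (n : ℕ) : Measure (Fin n → ℝ) :=
  Measure.pi fun _ => gaussianReal 0 ⟨σ ^ 2, sq_nonneg σ⟩

/-- Law of one observation `(X, Y)` with `Y = f(X) + ξ`. -/
def pairLaw (μdens : ℝ → ℝ) (σ : ℝ) (f : ℝ → ℝ) : Measure (ℝ × ℝ) :=
  ((designMeasure μdens).prod (gaussianReal 0 ⟨σ ^ 2, sq_nonneg σ⟩)).map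
    fun p => (p.1, f p.1 + p.2)

/-- Joint law `P^n_{f,μ}` of the `n` observations `(X_i, Y_i)`. -/
def jointLaw (μdens : ℝ → ℝ) (σ : ℝ) (f : ℝ → ℝ) (n : ℕ) : Measure (Fin n → ℝ × ℝ) :=
  Measure.pi fun _ => pairLaw μdens σ f

/-- Pointwise minimax risk (to the power `p`, in `ℝ≥0∞`) over the class `F`:
`(inf_{T} sup_{f ∈ F} E^n_{f,μ} |T - f(x₀)|^p)^{1/p}`, the infimum running over
all measurable estimators. -/
def minimaxRiskE (μdens : ℝ → ℝ) (σ : ℝ) (n : ℕ) (F : Set (ℝ → ℝ)) (x₀ p : ℝ) : ℝ≥0∞ :=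
  (⨅ T : {T : (Fin n → ℝ × ℝ) → ℝ // Measurable T},
      ⨆ f ∈ F, ∫⁻ d, ENNReal.ofReal (|T.1 d - f x₀| ^ p) ∂(jointLaw μdens σ f n)) ^ (1 / p)

/-- `N_{n,h}` : number of design points in `[x₀ - h, x₀ + h]`. -/
def Nnh {n : ℕ} (X : Fin n → ℝ) (x₀ h : ℝ) : ℕ :=
  (Finset.univ.filter fun i => |X i - x₀| ≤ h).card

/-- The data-driven bandwidth `H_n = inf {h ∈ [0,1] : ω(h) ≥ σ / sqrt N_{n,h}}`. -/
def Hband {n : ℕ} (X : Fin n → ℝ) (x₀ σ : ℝ) (ω : ℝ → ℝ) : ℝ :=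
  sInf {h : ℝ | h ∈ Set.Icc (0:ℝ) 1 ∧ σ ≤ ω h * Real.sqrt (Nnh X x₀ h)}

/-- The rectangular kernel `½ 1_{|x| ≤ 1}`. -/
def rectKernel : ℝ → ℝ := fun x => if |x| ≤ 1 then 1 / 2 else 0

/-- Assumption K on the kernel. -/
def AssumptionK (K : ℝ → ℝ) : Prop :=
  K = rectKernel ∨
    ((∀ x, 0 ≤ K x) ∧ (∀ x : ℝ, 1 < |x| → K x = 0) ∧ (∀ x, K (-x) = K x) ∧
      (∀ x, K x ≤ 1) ∧ ∃ C : ℝ, 0 < C ∧ ∃ κ : ℝ, 0 < κ ∧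
        ∀ x y : ℝ, |K x - K y| ≤ C * |x - y| ^ κ)

/-- `K_∞ = sup K`. -/
def kernelSup (K : ℝ → ℝ) : ℝ := ⨆ x, K x

/-- Smallest eigenvalue of a symmetric matrix, via
`λ(M) = inf_{‖x‖ = 1} ⟨x, M x⟩`. -/
def minEig {m : ℕ} (M : Matrix (Fin m) (Fin m) ℝ) : ℝ :=
  sInf {r : ℝ | ∃ x : Fin m → ℝ, (∑ i, x i ^ 2) = 1 ∧ r = x ⬝ᵥ M.mulVec x}

/-- The matrix `X^K_h` with entries `⟨φ_{j,h}, φ_{l,h}⟩_{h,K}`. -/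
def XmatK {n : ℕ} (X : Fin n → ℝ) (x₀ h : ℝ) (K : ℝ → ℝ) (k : ℕ) :
    Matrix (Fin (k + 1)) (Fin (k + 1)) ℝ :=
  Matrix.of fun j l => ∑ i, ((X i - x₀) / h) ^ ((j : ℕ) + (l : ℕ)) * K ((X i - x₀) / h)

/-- The vector `Y^K_h` with entries `⟨Y, φ_{j,h}⟩_{h,K}`. -/
def YvecK {n : ℕ} (X Y : Fin n → ℝ) (x₀ h : ℝ) (K : ℝ → ℝ) (k : ℕ) : Fin (k + 1) → ℝ :=
  fun j => ∑ i, Y i * ((X i - x₀) / h) ^ (j : ℕ) * K ((X i - x₀) / h)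

/-- The renormalized matrix `𝒳^K_h = N_{n,h}⁻¹ X^K_h`. -/
def scalXmat {n : ℕ} (X : Fin n → ℝ) (x₀ h : ℝ) (K : ℝ → ℝ) (k : ℕ) :
    Matrix (Fin (k + 1)) (Fin (k + 1)) ℝ :=
  ((Nnh X x₀ h : ℝ))⁻¹ • XmatK X x₀ h K k

/-- The corrected matrix
`X̃^K_h = X^K_h + N_{n,h}^{1/2} I · 1_{λ(X^K_h) ≤ N_{n,h}^{1/2}}`. -/
def XmatTilde {n : ℕ} (X : Fin n → ℝ) (x₀ h : ℝ) (K : ℝ → ℝ) (k : ℕ) :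
    Matrix (Fin (k + 1)) (Fin (k + 1)) ℝ :=
  XmatK X x₀ h K k +
    (if minEig (XmatK X x₀ h K k) ≤ Real.sqrt (Nnh X x₀ h)
      then Real.sqrt (Nnh X x₀ h) else 0) • (1 : Matrix (Fin (k + 1)) (Fin (k + 1)) ℝ)

/-- The (corrected) local polynomial estimator `f̂_h(x₀) = θ̂₀` where
`X̃^K_h θ̂ = Y^K_h`, and `f̂_h = 0` when `N_{n,h} = 0`. -/
def lpEstim {n : ℕ} (X Y : Fin n → ℝ) (x₀ h : ℝ) (K : ℝ → ℝ) (k : ℕ) : ℝ :=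
  if Nnh X x₀ h = 0 then 0 else (XmatTilde X x₀ h K k)⁻¹.mulVec (YvecK X Y x₀ h K k) 0

/-- The event `Ω^K_h = {λ(𝒳^K_h) > N_{n,h}^{-1/2}, N_{n,h} > 0}`. -/
def goodEvent {n : ℕ} (X : Fin n → ℝ) (x₀ h : ℝ) (K : ℝ → ℝ) (k : ℕ) : Prop :=
  (Real.sqrt (Nnh X x₀ h))⁻¹ < minEig (scalXmat X x₀ h K k) ∧ 0 < Nnh X x₀ h

/-- The constant `m(p) = sqrt(2/π) ∫_0^∞ (1+t)^p e^{-t²/2} dt`. -/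
def mconst (p : ℝ) : ℝ :=
  Real.sqrt (2 / Real.pi) * ∫ t in Set.Ioi (0:ℝ), (1 + t) ^ p * Real.exp (-t ^ 2 / 2)

/-- `K_{n,h,α} = Σ_i ((X_i - x₀)/h)^α K((X_i - x₀)/h)`. -/
def Ksum {n : ℕ} (X : Fin n → ℝ) (x₀ h : ℝ) (α : ℕ) (K : ℝ → ℝ) : ℝ :=
  ∑ i, ((X i - x₀) / h) ^ α * K ((X i - x₀) / h)

/-- The limit matrix `𝒳_{β,K}` with entries
`((β+1)/2)(1+(-1)^{j+l}) ∫_0^1 y^{j+l+β} K(y) dy`. -/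
def limitMat (β : ℝ) (K : ℝ → ℝ) (k : ℕ) : Matrix (Fin (k + 1)) (Fin (k + 1)) ℝ :=
  Matrix.of fun j l => ((β + 1) / 2) * (1 + (-1 : ℝ) ^ ((j : ℕ) + (l : ℕ))) *
    ∫ y in (0:ℝ)..1, y ^ (((j : ℕ) : ℝ) + ((l : ℕ) : ℝ) + β) * K y

/-- Kullback–Leibler divergence `∫ log (dP/dQ) dP`. -/
def KLdiv {α : Type*} [MeasurableSpace α] (P Q : Measure α) : ℝ :=
  ∫ x, Real.log ((P.rnDeriv Q x).toReal) ∂P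

/-- Design part of a data sample. -/
def dataX {n : ℕ} (d : Fin n → ℝ × ℝ) : Fin n → ℝ := fun i => (d i).1

/-- Response part of a data sample. -/
def dataY {n : ℕ} (d : Fin n → ℝ × ℝ) : Fin n → ℝ := fun i => (d i).2

/-- The estimator `f̂_n(x₀) = f̂_{H_n}(x₀)` with the data-driven bandwidth,
as a function of the data. -/
def fhatData {n : ℕ} (d : Fin n → ℝ × ℝ) (x₀ σ : ℝ) (ω K : ℝ → ℝ) (k : ℕ) : ℝ :=
  lpEstim (dataX d) (dataY d) x₀ (Hband (dataX d) x₀ σ ω) K k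

lemma exp_le_one_add_add_sq_div {c u : ℝ} (hc : c < 3) (hu : |u| ≤ c) :
    Real.exp u ≤ 1 + u + u ^ 2 / (2 * (1 - c / 3)) := by
  have hc0 : 0 ≤ c := (abs_nonneg u).trans hu
  have hfac : ∀ k : ℕ, (2 : ℝ) * 3 ^ k ≤ ((k + 2).factorial : ℝ) := by
    intro k
    induction k with
    | zero => norm_num [Nat.factorial]
    | succ k ih =>
      rw [show k + 1 + 2 = (k + 2) + 1 by ring, Nat.factorial_succ, pow_succ]
      push_cast
      have : (3 : ℝ) ≤ (k : ℝ) + 2 + 1 := by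
        have : (0 : ℝ) ≤ k := k.cast_nonneg
        linarith
      nlinarith [pow_pos (show (0 : ℝ) < 3 by norm_num) k]
  have h1 : HasSum (fun k : ℕ => u ^ k / (k.factorial : ℝ)) (Real.exp u) := by
    rw [Real.exp_eq_exp_ℝ]
    exact NormedSpace.expSeries_div_hasSum_exp u
  have h2 := (hasSum_nat_add_iff' 2).2 h1
  have h3 : HasSum (fun k : ℕ => u ^ 2 / 2 * (c / 3) ^ k) (u ^ 2 / 2 * (1 - c / 3)⁻¹) :=
    (hasSum_geometric_of_lt_one (by positivity) (by linarith)).mul_left _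
  have h4 := hasSum_le (fun k => ?_) h2 h3
  · simp only [Finset.sum_range_succ, Finset.sum_range_zero, pow_zero, pow_one,
      Nat.factorial_zero, Nat.factorial_one, Nat.cast_one, div_one, zero_add] at h4
    rw [div_mul_eq_div_div, div_eq_mul_inv (u ^ 2 / 2)]
    linarith
  · calc u ^ (k + 2) / ((k + 2).factorial : ℝ)
        ≤ |u| ^ (k + 2) / ((k + 2).factorial : ℝ) := by
          rw [← abs_pow]
          gcongr
          exact le_abs_self _
      _ ≤ |u| ^ (k + 2) / (2 * 3 ^ k) := by
          gcongr
          exact hfac k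
      _ = |u| ^ k * (u ^ 2 / (2 * 3 ^ k)) := by rw [pow_add, sq_abs]; ring
      _ ≤ c ^ k * (u ^ 2 / (2 * 3 ^ k)) := by gcongr
      _ = u ^ 2 / 2 * (c / 3) ^ k := by rw [div_pow]; field_simp

/-- Bernstein's inequality for a sum of i.i.d. variables bounded by `1`. -/
lemma measure_pi_sum_ge_le {E : Type*} [MeasurableSpace E] (P : Measure E)
    [IsProbabilityMeasure P] {Z : E → ℝ} (hZ : Measurable Z) (hZ1 : ∀ x, |Z x| ≤ 1)
    {v ε : ℝ} (hv : 0 ≤ v) (hε : 0 < ε) (hvar : ∫ x, Z x ^ 2 ∂P ≤ 2 * v) (n : ℕ) :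
    (Measure.pi fun _ : Fin n => P).real
        {X | n * (∫ x, Z x ∂P + v * ε / 2) ≤ ∑ i, Z (X i)} ≤
      Real.exp (-(ε ^ 2 / (8 * (2 + ε / 3))) * n * v) := by
  set l : ℝ := (ε / 2) / (2 + ε / 6) with hl
  have hl0 : 0 < l := by positivity
  have hl3 : l < 3 := by rw [hl, div_lt_iff₀ (by positivity)]; linarith
  have hint : ∀ f : E → ℝ, Measurable f → (∃ C, ∀ x, |f x| ≤ C) → Integrable f P := by
    rintro f hf ⟨C, hC⟩
    exact Integrable.of_bound hf.aestronglyMeasurable C (Eventually.of_forall hC)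
  have hZi : Integrable Z P := hint Z hZ ⟨1, hZ1⟩
  have hZ2i : Integrable (fun x => Z x ^ 2) P := hint _ (by fun_prop) ⟨1, fun x => by
    rw [abs_pow]; exact pow_le_one₀ (abs_nonneg _) (hZ1 x)⟩
  set m := ∫ x, Z x ∂P
  have hexp_le : ∀ x, Real.exp (l * Z x) ≤ 1 + l * Z x + l ^ 2 / (2 * (1 - l / 3)) * Z x ^ 2 := by
    intro x
    have := exp_le_one_add_add_sq_div (c := l) (u := l * Z x) hl3
      (by rw [abs_mul, abs_of_pos hl0]; nlinarith [hZ1 x])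
    convert this using 2
    ring
  have hmgf : mgf Z P l ≤ Real.exp (l * m + l ^ 2 / (2 * (1 - l / 3)) * (2 * v)) := by
    calc mgf Z P l ≤ ∫ x, (1 + l * Z x + l ^ 2 / (2 * (1 - l / 3)) * Z x ^ 2) ∂P := by
          refine integral_mono (hint _ (by fun_prop) ⟨Real.exp l, fun x => ?_⟩)
            (((integrable_const _).add (hZi.const_mul _)).add (hZ2i.const_mul _)) hexp_le
          rw [Real.abs_exp]
          exact Real.exp_le_exp.2 (by nlinarith [(abs_le.1 (hZ1 x)).2])
      _ = 1 + l * m + l ^ 2 / (2 * (1 - l / 3)) * ∫ x, Z x ^ 2 ∂P := by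
          have hlin : Integrable (fun x => 1 + l * Z x) P :=
            (integrable_const _).add (hZi.const_mul _)
          rw [integral_add hlin (hZ2i.const_mul _),
            integral_add (integrable_const _) (hZi.const_mul _), integral_const_mul,
            integral_const_mul]
          simp [m]
      _ ≤ 1 + l * m + l ^ 2 / (2 * (1 - l / 3)) * (2 * v) := by
          have : 0 ≤ l ^ 2 / (2 * (1 - l / 3)) := by
            have : 0 < 1 - l / 3 := by linarith
            positivity
          gcongr
      _ ≤ _ := by
          refine le_trans (le_of_eq ?_) (Real.add_one_le_exp _)
          ring
  have hind : iIndepFun (fun (i : Fin n) (X : Fin n → E) => Z (X i)) (Measure.pi fun _ => P) :=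
    iIndepFun_pi fun _ => hZ.aemeasurable
  have hmgf_i : ∀ i : Fin n,
      mgf (fun X : Fin n → E => Z (X i)) (Measure.pi fun _ => P) l = mgf Z P l := by
    intro i
    have h := (measurePreserving_eval (fun _ : Fin n => P) i).map_eq
    conv_rhs => rw [← h]
    exact (mgf_map (measurable_pi_apply i).aemeasurable
      (Measurable.aestronglyMeasurable (by fun_prop))).symm
  have hbd : ∀ X : Fin n → E, |∑ i, Z (X i)| ≤ n := by
    intro X
    refine (Finset.abs_sum_le_sum_abs _ _).trans ?_
    refine (Finset.sum_le_sum fun i _ => hZ1 (X i)).trans ?_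
    simp
  have hch := measure_ge_le_exp_mul_mgf (μ := Measure.pi fun _ : Fin n => P)
    (X := ∑ i : Fin n, fun X : Fin n → E => Z (X i)) (n * (m + v * ε / 2)) hl0.le
    (Integrable.of_bound (C := Real.exp (l * n)) (Measurable.aestronglyMeasurable (by fun_prop))
      (Eventually.of_forall fun X => by
        rw [Real.norm_eq_abs, Real.abs_exp, Finset.sum_apply]
        exact Real.exp_le_exp.2 (by nlinarith [(abs_le.1 (hbd X)).2])))
  rw [hind.mgf_sum (fun i => by fun_prop)] at hch
  simp only [hmgf_i, Finset.prod_const, Finset.card_univ, Fintype.card_fin,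
    Finset.sum_apply] at hch
  refine hch.trans ?_
  calc Real.exp (-l * (n * (m + v * ε / 2))) * mgf Z P l ^ n
      ≤ Real.exp (-l * (n * (m + v * ε / 2))) *
          Real.exp (l * m + l ^ 2 / (2 * (1 - l / 3)) * (2 * v)) ^ n := by
        gcongr
        exact mgf_nonneg
    _ = Real.exp (-(l * (ε / 2) - l ^ 2 / (1 - l / 3)) * n * v) := by
        rw [← Real.exp_nat_mul, ← Real.exp_add]
        congr 1
        have : 1 - l / 3 ≠ 0 := by linarith
        field_simp
        ring
    _ ≤ _ := by
        have h1 : l * (ε / 2) - l ^ 2 / (1 - l / 3) = ε ^ 2 / (8 * (2 + ε / 6)) := by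
          have h2 : 1 - l / 3 = 2 / (2 + ε / 6) := by rw [hl]; field_simp; ring
          rw [h2, hl]
          field_simp
          ring
        rw [h1]
        gcongr
        norm_num

/-- The increments of `F` over the uniform grid of mesh `1 / N`, weighted by the values of `g` at
the left endpoints. -/
def stieltjesSum (g F : ℝ → ℝ) (N : ℕ) : ℝ :=
  ∑ i ∈ Finset.range N, g (i / N) * (F ((i + 1 : ℕ) / N) - F ((i : ℕ) / N))

lemma abs_integral_sub_stieltjesSum_le {g w : ℝ → ℝ} {h ω : ℝ} {N : ℕ} (hh : 0 < h) (hN : 0 < N)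
    (hg : ContinuousOn g (Icc 0 1)) (hw0 : ∀ t ∈ Ioc 0 h, 0 ≤ w t)
    (hw : IntervalIntegrable w volume 0 h)
    (hω : ∀ x ∈ Icc (0 : ℝ) 1, ∀ y ∈ Icc (0 : ℝ) 1, |x - y| ≤ 1 / N → |g x - g y| ≤ ω) :
    |(∫ t in (0 : ℝ)..h, g (t / h) * w t) - stieltjesSum g (fun y => Fnu w (h * y)) N| ≤
      ω * Fnu w h := by
  have hN' : (0 : ℝ) < N := by exact_mod_cast hN
  set a : ℕ → ℝ := fun i => h * ((i : ℕ) / N) with ha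
  have ha0 : ∀ i, 0 ≤ a i := fun i => by positivity
  have hah : ∀ i ≤ N, a i ≤ h := fun i hi => by
    have : (i : ℝ) / N ≤ 1 := div_le_one_of_le₀ (by exact_mod_cast hi) hN'.le
    simp only [ha]; nlinarith
  have haa : ∀ i, a i ≤ a (i + 1) := fun i => by
    simp only [ha]; gcongr; simp
  have hgc : ContinuousOn (fun t => g (t / h)) (uIcc 0 h) := by
    rw [uIcc_of_le hh.le]
    refine hg.comp (by fun_prop) fun t ht => ⟨div_nonneg ht.1 hh.le, div_le_one_of_le₀ ht.2 hh.le⟩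
  have hgw : IntervalIntegrable (fun t => g (t / h) * w t) volume 0 h := hw.continuousOn_mul hgc
  have hsub : ∀ i < N, uIcc (a i) (a (i + 1)) ⊆ uIcc 0 h := fun i hi => by
    rw [uIcc_of_le (haa i), uIcc_of_le hh.le]
    exact Icc_subset_Icc (ha0 i) (hah _ hi)
  have hwi : ∀ i < N, IntervalIntegrable w volume (a i) (a (i + 1)) :=
    fun i hi => hw.mono_set (hsub i hi)
  have hgwi : ∀ i < N, IntervalIntegrable (fun t => g (t / h) * w t) volume (a i) (a (i + 1)) :=
    fun i hi => hgw.mono_set (hsub i hi)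
  have ha_zero : a 0 = 0 := by simp [ha]
  have ha_N : a N = h := by simp only [ha]; field_simp
  have h1 := intervalIntegral.sum_integral_adjacent_intervals hgwi
  have h2 := intervalIntegral.sum_integral_adjacent_intervals hwi
  rw [ha_zero, ha_N] at h1 h2
  have hF : ∀ i < N, Fnu w (a (i + 1)) - Fnu w (a i) = ∫ t in a i..a (i + 1), w t := fun i hi => by
    refine intervalIntegral.integral_interval_sub_left ?_ ?_
    · refine hw.mono_set ?_
      rw [uIcc_of_le (ha0 _), uIcc_of_le hh.le]
      exact Icc_subset_Icc le_rfl (hah _ hi)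
    · refine hw.mono_set ?_
      rw [uIcc_of_le (ha0 _), uIcc_of_le hh.le]
      exact Icc_subset_Icc le_rfl (hah _ hi.le)
  rw [← h1, stieltjesSum, ← Finset.sum_sub_distrib, Fnu, ← h2, Finset.mul_sum]
  refine (Finset.abs_sum_le_sum_abs _ _).trans (Finset.sum_le_sum fun i hi => ?_)
  have hi' : i < N := Finset.mem_range.1 hi
  have hFi := hF i hi'
  simp only [ha] at hFi
  rw [hFi, ← intervalIntegral.integral_const_mul,
    ← intervalIntegral.integral_sub (hgwi i hi') ((hwi i hi').const_mul _),
    ← intervalIntegral.integral_const_mul, ← Real.norm_eq_abs]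
  refine intervalIntegral.norm_integral_le_of_norm_le (haa i)
    (Eventually.of_forall fun t ht => ?_) ((hwi i hi').const_mul _)
  have ht0 : t ∈ Ioc 0 h := ⟨(ha0 i).trans_lt ht.1, ht.2.trans (hah _ hi')⟩
  rw [← sub_mul, norm_mul, Real.norm_eq_abs, Real.norm_eq_abs, abs_of_nonneg (hw0 t ht0)]
  refine mul_le_mul_of_nonneg_right (hω _ ⟨div_nonneg ht0.1.le hh.le,
    div_le_one_of_le₀ ht0.2 hh.le⟩ _ ⟨by positivity, div_le_one_of_le₀ ?_ hN'.le⟩ ?_) (hw0 t ht0)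
  · exact_mod_cast hi'.le
  · have e1 : (i : ℝ) / N < t / h := by
      rw [lt_div_iff₀ hh, mul_comm]; exact ht.1
    have e2 : t / h ≤ ((i : ℝ) + 1) / N := by
      rw [div_le_iff₀ hh, mul_comm]
      have := ht.2
      simp only [ha] at this
      exact_mod_cast this
    rw [abs_of_pos (by linarith)]
    rw [add_div] at e2
    linarith

lemma intervalIntegrable_of_integrableOn_Ioc {ν : ℝ → ℝ} {δ h : ℝ}
    (hint : IntegrableOn ν (Ioc 0 δ)) (hh : 0 ≤ h) (hδ : h ≤ δ) :
    IntervalIntegrable ν volume 0 h :=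
  (intervalIntegrable_iff_integrableOn_Ioc_of_le hh).2
    (hint.mono_set (Ioc_subset_Ioc le_rfl hδ))

lemma Fnu_pos {ν : ℝ → ℝ} {h : ℝ} (hpos : ∀ t, 0 < t → 0 < ν t) (hh : 0 < h)
    (hint : IntervalIntegrable ν volume 0 h) : 0 < Fnu ν h :=
  intervalIntegral.intervalIntegral_pos_of_pos_on hint (fun t ht => hpos t ht.1) hh

/-- The primitive of a regularly varying function of index `β` is regularly varying of index
`β + 1`. -/
lemma tendsto_Fnu_div {ν : ℝ → ℝ} {β δ : ℝ} (hν : RegVaryAt0 ν β) (hδ : 0 < δ)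
    (hint : IntegrableOn ν (Ioc 0 δ)) {y : ℝ} (hy : 0 < y) (hy1 : y ≤ 1) :
    Tendsto (fun h => Fnu ν (h * y) / Fnu ν h) (nhdsWithin 0 (Ioi 0)) (nhds (y ^ (β + 1))) := by
  rw [Metric.tendsto_nhds]
  intro e he
  have hlim := Metric.tendsto_nhds.1 (hν.2.2 y hy) (e / 2) (by positivity)
  obtain ⟨d, hd, hball⟩ := mem_nhdsGT_iff_exists_Ioc_subset.1 hlim
  have hd0 : 0 < d := hd
  filter_upwards [Ioc_mem_nhdsGT (lt_min hd0 hδ)] with h hh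
  have hh0 : 0 < h := hh.1
  have hhd : h ≤ d := hh.2.trans (min_le_left _ _)
  have hI := intervalIntegrable_of_integrableOn_Ioc hint hh0.le (hh.2.trans (min_le_right _ _))
  have hF := Fnu_pos hν.1 hh0 hI
  have hhy : h * y ≤ h := by nlinarith
  have hI' : IntervalIntegrable (fun t => ν (y * t)) volume 0 h := by
    have h0 : IntervalIntegrable ν volume (y * 0) (y * h) := by
      rw [mul_zero]
      refine intervalIntegrable_of_integrableOn_Ioc hint (by positivity) ?_
      rw [mul_comm]
      exact hhy.trans (hh.2.trans (min_le_right _ _))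
    simpa [hy.ne'] using h0.comp_mul_left (c := y)
  have hsub : Fnu ν (h * y) = y * ∫ t in (0 : ℝ)..h, ν (y * t) := by
    rw [intervalIntegral.mul_integral_comp_mul_left, mul_zero, Fnu, mul_comm]
  have hbound : |(∫ t in (0 : ℝ)..h, ν (y * t)) - y ^ β * Fnu ν h| ≤ e / 2 * Fnu ν h := by
    rw [Fnu, ← intervalIntegral.integral_const_mul, ← intervalIntegral.integral_const_mul,
      ← intervalIntegral.integral_sub hI' (hI.const_mul _), ← Real.norm_eq_abs]
    refine intervalIntegral.norm_integral_le_of_norm_le hh0.le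
      (Eventually.of_forall fun t ht => ?_) (hI.const_mul _)
    have hνt := hν.1 t ht.1
    have hb : dist (ν (y * t) / ν t) (y ^ β) < e / 2 := hball ⟨ht.1, ht.2.trans hhd⟩
    rw [Real.dist_eq] at hb
    have : ν (y * t) - y ^ β * ν t = (ν (y * t) / ν t - y ^ β) * ν t := by field_simp
    rw [this, norm_mul, Real.norm_eq_abs, Real.norm_eq_abs, abs_of_pos hνt]
    gcongr
  rw [Real.dist_eq, hsub, Real.rpow_add_one hy.ne']
  have : y * (∫ t in (0 : ℝ)..h, ν (y * t)) / Fnu ν h - y ^ β * y =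
      y * (((∫ t in (0 : ℝ)..h, ν (y * t)) - y ^ β * Fnu ν h) / Fnu ν h) := by field_simp
  rw [this, abs_mul, abs_div, abs_of_pos hy, abs_of_pos hF]
  have h3 : |(∫ t in (0 : ℝ)..h, ν (y * t)) - y ^ β * Fnu ν h| / Fnu ν h ≤ e / 2 :=
    (div_le_iff₀ hF).2 hbound
  have h4 : 0 ≤ |(∫ t in (0 : ℝ)..h, ν (y * t)) - y ^ β * Fnu ν h| / Fnu ν h := by positivity
  nlinarith

lemma exists_modulus_of_continuousOn_Icc {g : ℝ → ℝ} (hg : ContinuousOn g (Icc 0 1)) {ω : ℝ}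
    (hω : 0 < ω) : ∃ N : ℕ, 0 < N ∧
      ∀ x ∈ Icc (0 : ℝ) 1, ∀ y ∈ Icc (0 : ℝ) 1, |x - y| ≤ 1 / N → |g x - g y| ≤ ω := by
  have hu := isCompact_Icc.uniformContinuousOn_of_continuous hg
  obtain ⟨d, hd, hdg⟩ := Metric.uniformContinuousOn_iff.1 hu ω hω
  obtain ⟨k, hk⟩ := exists_nat_one_div_lt hd
  refine ⟨k + 1, k.succ_pos, fun x hx y hy hxy => ?_⟩
  have := hdg x hx y hy (by rw [Real.dist_eq]; push_cast at hxy; linarith)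
  rw [Real.dist_eq] at this
  exact this.le

/-- The limit of the rescaled distribution functions `y ↦ F_ν(h y) / F_ν(h)`. -/
def limitCdf (β y : ℝ) : ℝ := if y = 0 then 0 else y ^ (β + 1)

lemma tendsto_integral_div_Fnu {ν g : ℝ → ℝ} {β δ L : ℝ} (hν : RegVaryAt0 ν β) (hδ : 0 < δ)
    (hint : IntegrableOn ν (Ioc 0 δ)) (hg : ContinuousOn g (Icc 0 1))
    (hL : ∀ (ω : ℝ) (N : ℕ), 0 < N →
      (∀ x ∈ Icc (0 : ℝ) 1, ∀ y ∈ Icc (0 : ℝ) 1, |x - y| ≤ 1 / N → |g x - g y| ≤ ω) →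
      |L - stieltjesSum g (limitCdf β) N| ≤ ω) :
    Tendsto (fun h => (∫ t in (0 : ℝ)..h, g (t / h) * ν t) / Fnu ν h) (nhdsWithin 0 (Ioi 0))
      (nhds L) := by
  rw [Metric.tendsto_nhds]
  intro e he
  obtain ⟨N, hN, hmod⟩ := exists_modulus_of_continuousOn_Icc hg (show 0 < e / 3 by positivity)
  have hF : ∀ i ≤ N, Tendsto (fun h => Fnu ν (h * ((i : ℕ) / N)) / Fnu ν h)
      (nhdsWithin 0 (Ioi 0)) (nhds (limitCdf β ((i : ℕ) / N))) := by
    intro i hi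
    have hN' : (0 : ℝ) < N := by exact_mod_cast hN
    rcases Nat.eq_zero_or_pos i with rfl | hi0
    · simp [limitCdf, Fnu]
    · have hiN : (0 : ℝ) < (i : ℝ) / N := by positivity
      rw [limitCdf, if_neg hiN.ne']
      exact tendsto_Fnu_div hν hδ hint hiN (div_le_one_of_le₀ (by exact_mod_cast hi) hN'.le)
  have hS : Tendsto (fun h => stieltjesSum g (fun y => Fnu ν (h * y)) N / Fnu ν h)
      (nhdsWithin 0 (Ioi 0)) (nhds (stieltjesSum g (limitCdf β) N)) := by
    simp only [stieltjesSum, Finset.sum_div, mul_div_assoc, sub_div]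
    refine tendsto_finsetSum _ fun i hi => ?_
    have hi' := Finset.mem_range.1 hi
    exact ((hF (i + 1) hi').sub (hF i hi'.le)).const_mul _
  filter_upwards [Metric.tendsto_nhds.1 hS (e / 3) (by positivity), Ioc_mem_nhdsGT hδ] with h h1 hh
  have hI := intervalIntegrable_of_integrableOn_Ioc hint hh.1.le hh.2
  have hFp := Fnu_pos hν.1 hh.1 hI
  have h2 := abs_integral_sub_stieltjesSum_le hh.1 hN hg (fun t ht => (hν.1 t ht.1).le) hI hmod
  have h3 := hL _ N hN hmod
  replace h2 := (div_le_iff₀ hFp).2 h2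
  nth_rewrite 1 [← abs_of_pos hFp] at h2
  rw [← abs_div, sub_div] at h2
  rw [Real.dist_eq] at h1 ⊢
  rw [abs_le] at h2 h3
  rw [abs_lt] at h1 ⊢
  constructor <;> linarith [h1.1, h1.2, h2.1, h2.2, h3.1, h3.2]

lemma Fnu_rpow {β : ℝ} (hβ : -1 < β) (y : ℝ) :
    Fnu (fun t => (β + 1) * t ^ β) y = limitCdf β y := by
  have hβ' : β + 1 ≠ 0 := by linarith
  rw [Fnu, intervalIntegral.integral_const_mul, integral_rpow (Or.inl hβ),
    Real.zero_rpow hβ', limitCdf]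
  split_ifs with h
  · simp [h, Real.zero_rpow hβ']
  · field_simp
    ring

lemma tendsto_integral_div_Fnu_of_neg_one_lt {ν g : ℝ → ℝ} {β δ : ℝ} (hβ : -1 < β)
    (hν : RegVaryAt0 ν β) (hδ : 0 < δ) (hint : IntegrableOn ν (Ioc 0 δ))
    (hg : ContinuousOn g (Icc 0 1)) :
    Tendsto (fun h => (∫ t in (0 : ℝ)..h, g (t / h) * ν t) / Fnu ν h) (nhdsWithin 0 (Ioi 0))
      (nhds (∫ t in (0 : ℝ)..1, g t * ((β + 1) * t ^ β))) := by
  refine tendsto_integral_div_Fnu hν hδ hint hg fun ω N hN hω => ?_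
  have h := abs_integral_sub_stieltjesSum_le (w := fun t => (β + 1) * t ^ β) one_pos hN hg
    (fun t ht => mul_nonneg (by linarith) (Real.rpow_nonneg ht.1.le _))
    ((intervalIntegral.intervalIntegrable_rpow' hβ).const_mul _) hω
  have hS : stieltjesSum g (fun y => Fnu (fun t => (β + 1) * t ^ β) (1 * y)) N =
      stieltjesSum g (limitCdf β) N := by
    refine Finset.sum_congr rfl fun i _ => ?_
    dsimp only
    rw [one_mul, one_mul, Fnu_rpow hβ, Fnu_rpow hβ]
  rw [hS, Fnu_rpow hβ] at h
  simpa [limitCdf] using h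

lemma tendsto_integral_div_Fnu_of_eq_neg_one {ν g : ℝ → ℝ} {δ : ℝ}
    (hν : RegVaryAt0 ν (-1)) (hδ : 0 < δ) (hint : IntegrableOn ν (Ioc 0 δ))
    (hg : ContinuousOn g (Icc 0 1)) :
    Tendsto (fun h => (∫ t in (0 : ℝ)..h, g (t / h) * ν t) / Fnu ν h) (nhdsWithin 0 (Ioi 0))
      (nhds (g 0)) := by
  refine tendsto_integral_div_Fnu hν hδ hint hg fun ω N hN hω => ?_
  have hω0 : 0 ≤ ω := (abs_nonneg _).trans (hω 0 (by simp) 0 (by simp) (by simp))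
  have hS : stieltjesSum g (limitCdf (-1)) N = g 0 := by
    rw [stieltjesSum, Finset.sum_eq_single 0]
    · simp [limitCdf, hN.ne']
    · intro i _ hi
      have : ((i : ℝ) + 1) ≠ 0 := by positivity
      simp [limitCdf, hi, hN.ne', this]
    · simp [hN.ne']
  simpa [hS] using hω0

lemma eventually_integral_designMeasure_eq {μdens ν : ℝ → ℝ} {x₀ δ : ℝ}
    (hM : AssumptionM μdens ν x₀) (hmeas : Measurable μdens) (hpos : ∀ x, 0 ≤ μdens x)
    (hδ : 0 < δ) (hint : IntegrableOn ν (Ioc 0 δ)) :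
    ∀ᶠ h in nhdsWithin (0 : ℝ) (Ioi 0), ∀ f : ℝ → ℝ, Measurable f → (∀ x, |f x| ≤ 1) →
      (∀ x, 1 < |x| → f x = 0) →
      IntervalIntegrable (fun t => (f (t / h) + f (-(t / h))) * ν t) volume 0 h ∧
      ∫ x, f ((x - x₀) / h) ∂(designMeasure μdens) =
        ∫ t in (0 : ℝ)..h, (f (t / h) + f (-(t / h))) * ν t := by
  obtain ⟨-, -, W, hW, hWν⟩ := hM
  obtain ⟨r, hr, hrW⟩ := Metric.mem_nhds_iff.1 hW
  filter_upwards [Ioo_mem_nhdsGT (lt_min hr hδ)] with h hh f hf hf1 hf0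
  have hh0 : 0 < h := hh.1
  have hhr : h < r := hh.2.trans_le (min_le_left _ _)
  have hν := intervalIntegrable_of_integrableOn_Ioc hint hh0.le (hh.2.le.trans (min_le_right _ _))
  set ψ : ℝ → ℝ := fun u => μdens (u + x₀) * f (u / h) with hψ
  have hψ0 : ∀ u ∉ Icc (-h) h, ψ u = 0 := fun u hu => by
    have : f (u / h) = 0 := hf0 _ (by
      rw [abs_div, abs_of_pos hh0, lt_div_iff₀ hh0, one_mul]
      by_contra hcon
      exact hu (abs_le.1 (not_lt.1 hcon)))
    simp [hψ, this]
  have hψν : ∀ u, |u| ≤ h → ψ u = f (u / h) * ν |u| := fun u hu => by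
    have : u + x₀ ∈ W := hrW (by simpa [Real.dist_eq] using hu.trans_lt hhr)
    simp only [hψ]
    rw [hWν _ this, add_sub_cancel_right, mul_comm]
  have hbdd : ∀ s : ℝ, IntervalIntegrable (fun t => f (s * (t / h)) * ν t) volume 0 h := fun s => by
    rw [intervalIntegrable_iff] at hν ⊢
    exact hν.bdd_mul (c := 1) (Measurable.aestronglyMeasurable (by fun_prop))
      (Eventually.of_forall fun t => hf1 _)
  have hright : IntervalIntegrable (fun t => f (t / h) * ν t) volume 0 h := by
    simpa using hbdd 1
  have hleft : IntervalIntegrable (fun t => f (-(t / h)) * ν t) volume 0 h := by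
    simpa using hbdd (-1)
  have hcongr_right : ∀ t ∈ uIoc 0 h, ψ t = f (t / h) * ν t := fun t ht => by
    rw [uIoc_of_le hh0.le] at ht
    rw [hψν t (by rw [abs_of_pos ht.1]; exact ht.2), abs_of_pos ht.1]
  have hcongr_left : ∀ t ∈ uIoc 0 h, ψ (-t) = f (-(t / h)) * ν t := fun t ht => by
    rw [uIoc_of_le hh0.le] at ht
    rw [hψν (-t) (by rw [abs_neg, abs_of_pos ht.1]; exact ht.2), abs_neg, abs_of_pos ht.1,
      neg_div]
  have hψright : IntervalIntegrable ψ volume 0 h :=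
    hright.congr fun t ht => (hcongr_right t ht).symm
  have hψleft : IntervalIntegrable ψ volume (-h) 0 := by
    have h1 : IntervalIntegrable (fun t => ψ (-t)) volume 0 h :=
      hleft.congr fun t ht => (hcongr_left t ht).symm
    rw [IntervalIntegrable.iff_comp_neg] at h1
    simpa using h1.symm
  refine ⟨by simpa only [add_mul] using hright.add hleft, ?_⟩
  calc ∫ x, f ((x - x₀) / h) ∂(designMeasure μdens)
      = ∫ x, μdens x * f ((x - x₀) / h) := by
        rw [designMeasure, integral_withDensity_eq_integral_toReal_smul (by fun_prop)
          (Eventually.of_forall fun _ => ENNReal.ofReal_lt_top)]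
        simp only [ENNReal.toReal_ofReal (hpos _), smul_eq_mul]
    _ = ∫ u, ψ u := by
        rw [← integral_add_right_eq_self _ x₀]
        simp [hψ]
    _ = ∫ u in (-h)..h, ψ u := by
        rw [← setIntegral_eq_integral_of_forall_compl_eq_zero hψ0, integral_Icc_eq_integral_Ioc,
          intervalIntegral.integral_of_le (by linarith)]
    _ = (∫ t in (0 : ℝ)..h, ψ (-t)) + ∫ t in (0 : ℝ)..h, ψ t := by
        rw [← intervalIntegral.integral_add_adjacent_intervals hψleft hψright,
          intervalIntegral.integral_comp_neg, neg_zero]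
    _ = (∫ t in (0 : ℝ)..h, f (-(t / h)) * ν t) + ∫ t in (0 : ℝ)..h, f (t / h) * ν t := by
        rw [intervalIntegral.integral_congr_ae (Eventually.of_forall hcongr_left),
          intervalIntegral.integral_congr_ae (Eventually.of_forall hcongr_right)]
    _ = _ := by
        rw [add_comm, ← intervalIntegral.integral_add hright hleft]
        simp only [add_mul]

namespace AssumptionK

variable {K : ℝ → ℝ}

lemma nonneg (hK : AssumptionK K) (x : ℝ) : 0 ≤ K x := by
  rcases hK with rfl | h
  · unfold rectKernel
    split_ifs <;> norm_num
  · exact h.1 x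

lemma le_one (hK : AssumptionK K) (x : ℝ) : K x ≤ 1 := by
  rcases hK with rfl | h
  · unfold rectKernel
    split_ifs <;> norm_num
  · exact h.2.2.2.1 x

lemma eq_zero (hK : AssumptionK K) {x : ℝ} (hx : 1 < |x|) : K x = 0 := by
  rcases hK with rfl | h
  · simp [rectKernel, not_le.2 hx]
  · exact h.2.1 x hx

lemma map_neg (hK : AssumptionK K) (x : ℝ) : K (-x) = K x := by
  rcases hK with rfl | h
  · simp [rectKernel]
  · exact h.2.2.1 x

lemma continuous_of_abs_sub_le {C κ : ℝ} (hC : 0 < C) (hκ : 0 < κ)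
    (h : ∀ x y : ℝ, |K x - K y| ≤ C * |x - y| ^ κ) : Continuous K := by
  refine HolderWith.continuous (C := C.toNNReal) (r := κ.toNNReal) (fun x y => ?_)
    (by simpa using hκ)
  rw [edist_dist, edist_dist, Real.dist_eq, Real.dist_eq, Real.coe_toNNReal _ hκ.le,
    ENNReal.ofReal_rpow_of_nonneg (abs_nonneg _) hκ.le, ← ENNReal.ofReal,
    ← ENNReal.ofReal_mul hC.le]
  exact ENNReal.ofReal_le_ofReal (h x y)

lemma measurable (hK : AssumptionK K) : Measurable K := by
  rcases hK with rfl | ⟨-, -, -, -, C, hC, κ, hκ, h⟩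
  · exact Measurable.ite (measurableSet_le (by fun_prop) measurable_const) measurable_const
      measurable_const
  · exact (continuous_of_abs_sub_le hC hκ h).measurable

lemma continuousOn (hK : AssumptionK K) : ContinuousOn K (Icc 0 1) := by
  rcases hK with rfl | ⟨-, -, -, -, C, hC, κ, hκ, h⟩
  · refine (continuousOn_const (c := (1 / 2 : ℝ))).congr fun x hx => ?_
    rw [rectKernel, if_pos (abs_le.2 ⟨by linarith [hx.1], hx.2⟩)]
  · exact (continuous_of_abs_sub_le hC hκ h).continuousOn

lemma abs_pow_mul_le_one (hK : AssumptionK K) (α : ℕ) (x : ℝ) : |x ^ α * K x| ≤ 1 := by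
  rcases le_or_gt |x| 1 with hx | hx
  · rw [abs_mul, abs_pow, abs_of_nonneg (hK.nonneg x)]
    exact mul_le_one₀ (pow_le_one₀ (abs_nonneg _) hx) (hK.nonneg x) (hK.le_one x)
  · simp [hK.eq_zero hx]

end AssumptionK

lemma eventually_designLaw_Ksum_le {β L δ : ℝ} {K μdens ν : ℝ → ℝ} {x₀ : ℝ} {α : ℕ}
    (hK : AssumptionK K) (hν : RegVaryAt0 ν β) (hM : AssumptionM μdens ν x₀)
    (hmeas : Measurable μdens) (hpos : ∀ x, 0 ≤ μdens x)
    (hprob : IsProbabilityMeasure (designMeasure μdens))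
    (hδ : 0 < δ) (hint : IntegrableOn ν (Ioc 0 δ))
    {γseq : ℕ → ℝ} (hγ : Tendsto γseq atTop (nhdsWithin 0 (Ioi 0))) {ε : ℝ} (hε : 0 < ε)
    (hL : Tendsto (fun h => (∫ t in (0 : ℝ)..h,
      ((1 + (-1 : ℝ) ^ α) * (t / h) ^ α * K (t / h)) * ν t) / Fnu ν h)
      (nhdsWithin 0 (Ioi 0)) (nhds L)) :
    ∀ᶠ n : ℕ in atTop,
      designLaw μdens n {X | ε < |Ksum X x₀ (γseq n) α K / (n * Fnu ν (γseq n)) - L|} ≤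
        ENNReal.ofReal (2 * Real.exp (-(ε ^ 2 / (8 * (2 + ε / 3))) * n * Fnu ν (γseq n))) := by
  filter_upwards [eventually_gt_atTop 0,
    hγ.eventually (eventually_integral_designMeasure_eq hM hmeas hpos hδ hint),
    hγ.eventually (Metric.tendsto_nhds.1 hL (ε / 2) (by positivity)),
    hγ.eventually (Ioc_mem_nhdsGT hδ)] with n hn hexp hlim hh
  set h := γseq n
  have hI := intervalIntegrable_of_integrableOn_Ioc hint hh.1.le hh.2
  have hF := Fnu_pos hν.1 hh.1 hI
  have hn' : (0 : ℝ) < n := by exact_mod_cast hn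
  set f : ℝ → ℝ := fun x => x ^ α * K x with hf
  have hfm : Measurable f := by
    have := hK.measurable
    fun_prop
  have hf1 : ∀ x, |f x| ≤ 1 := hK.abs_pow_mul_le_one α
  have hf0 : ∀ x, 1 < |x| → f x = 0 := fun x hx => by simp [hf, hK.eq_zero hx]
  have hf21 : ∀ x, |f x ^ 2| ≤ 1 := fun x => by
    rw [abs_pow]; exact pow_le_one₀ (abs_nonneg _) (hf1 x)
  set Z : ℝ → ℝ := fun x => f ((x - x₀) / h) with hZ
  have hZm : Measurable Z := by fun_prop
  have hmean := (hexp f hfm hf1 hf0).2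
  obtain ⟨hvi, hvar⟩ := hexp (fun x => f x ^ 2) (by fun_prop) hf21
    (fun x hx => by simp [hf0 x hx])
  have hvar_le : ∫ x, Z x ^ 2 ∂(designMeasure μdens) ≤ 2 * Fnu ν h := by
    rw [hvar, Fnu, ← intervalIntegral.integral_const_mul]
    refine intervalIntegral.integral_mono_on_of_le_Ioo hh.1.le hvi (hI.const_mul _) fun t ht => ?_
    have h1 := (abs_le.1 (hf21 (t / h))).2
    have h2 := (abs_le.1 (hf21 (-(t / h)))).2
    exact mul_le_mul_of_nonneg_right (by linarith) (hν.1 t ht.1).le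
  set m := ∫ x, Z x ∂(designMeasure μdens)
  have hmL : |m / Fnu ν h - L| < ε / 2 := by
    rw [← Real.dist_eq, hmean]
    convert hlim using 5 with t
    simp only [hf, hK.map_neg]
    rw [neg_pow]
    ring
  have hup := measure_pi_sum_ge_le (designMeasure μdens) hZm (fun x => hf1 _) hF.le hε hvar_le n
  have hdown := measure_pi_sum_ge_le (designMeasure μdens) hZm.neg
    (fun x => by simpa using hf1 ((x - x₀) / h)) hF.le hε (by simpa using hvar_le) n
  refine (measure_mono (t := {X : Fin n → ℝ | n * (m + Fnu ν h * ε / 2) ≤ ∑ i, Z (X i)} ∪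
    {X : Fin n → ℝ | n * ((∫ x, (-Z) x ∂(designMeasure μdens)) + Fnu ν h * ε / 2) ≤
      ∑ i, (-Z) (X i)}) fun X hX => ?_).trans ((measure_union_le _ _).trans ?_)
  · have hS : Ksum X x₀ h α K = ∑ i, Z (X i) := rfl
    simp only [Set.mem_ofPred_eq, Set.mem_union, hS, Pi.neg_apply, integral_neg,
      Finset.sum_neg_distrib] at hX ⊢
    change _ ∨ n * (-m + _) ≤ _
    set S := ∑ i, Z (X i)
    have e1 : n * (m + Fnu ν h * ε / 2) = (m / Fnu ν h + ε / 2) * (n * Fnu ν h) := by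
      field_simp
    have e2 : n * (-m + Fnu ν h * ε / 2) = (-(m / Fnu ν h) + ε / 2) * (n * Fnu ν h) := by
      field_simp
    rw [e1, e2, ← le_div_iff₀ (by positivity), ← le_div_iff₀ (by positivity), neg_div]
    rw [abs_lt] at hmL
    rcases lt_abs.1 hX with hX | hX
    · left; linarith
    · right; linarith
  · rw [two_mul, ENNReal.ofReal_add (Real.exp_pos _).le (Real.exp_pos _).le]
    refine add_le_add ?_ ?_
    · rw [designLaw, ← ofReal_measureReal]
      exact ENNReal.ofReal_le_ofReal hup
    · rw [designLaw, ← ofReal_measureReal]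
      exact ENNReal.ofReal_le_ofReal hdown

/-- Lemma 5: Bernstein-type concentration of the weighted sums `K_{n,γ_n,α}`
for a regularly varying design, in the cases `β > -1` and `β = -1`. -/
theorem statement14 (β : ℝ) (K : ℝ → ℝ) (hK : AssumptionK K)
    (μdens ν : ℝ → ℝ) (x₀ : ℝ) (hν : RegVaryAt0 ν β)
    (hM : AssumptionM μdens ν x₀)
    (hmeas : Measurable μdens) (hpos : ∀ x, 0 ≤ μdens x)
    (hprob : IsProbabilityMeasure (designMeasure μdens))
    (hint : ∃ δ > (0:ℝ), MeasureTheory.IntegrableOn ν (Set.Ioc 0 δ))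
    (γseq : ℕ → ℝ) (hγpos : ∀ n, 0 < γseq n)
    (hγ0 : Filter.Tendsto γseq atTop (nhds 0))
    (α : ℕ) (ε : ℝ) (hε : 0 < ε) :
    (-1 < β → ∀ᶠ n : ℕ in atTop,
      designLaw μdens n
          {X | ε < |Ksum X x₀ (γseq n) α K / (n * Fnu ν (γseq n)) -
            (β + 1) * ((1 + (-1 : ℝ) ^ α) * ∫ y in (0:ℝ)..1, y ^ ((α : ℝ) + β) * K y)|} ≤
        ENNReal.ofReal (2 * Real.exp (-(ε ^ 2 / (8 * (2 + ε / 3))) * n * Fnu ν (γseq n)))) ∧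
    (β = -1 → ∀ᶠ n : ℕ in atTop,
      designLaw μdens n
          {X | ε < |Ksum X x₀ (γseq n) 0 K / (n * Fnu ν (γseq n)) - 2 * K 0|} ≤
        ENNReal.ofReal (2 * Real.exp (-(ε ^ 2 / (8 * (2 + ε / 3))) * n * Fnu ν (γseq n)))) := by
  obtain ⟨δ, hδ, hintδ⟩ := hint
  have hγ : Tendsto γseq atTop (nhdsWithin 0 (Ioi 0)) :=
    tendsto_nhdsWithin_iff.2 ⟨hγ0, Eventually.of_forall hγpos⟩
  have hcont : ∀ a : ℕ,
      ContinuousOn (fun y => (1 + (-1 : ℝ) ^ a) * y ^ a * K y) (Icc 0 1) := fun a =>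
    ContinuousOn.mul (by fun_prop) hK.continuousOn
  refine ⟨fun hβ => ?_, fun hβ => ?_⟩
  · refine eventually_designLaw_Ksum_le hK hν hM hmeas hpos hprob hδ hintδ hγ hε ?_
    convert tendsto_integral_div_Fnu_of_neg_one_lt hβ hν hδ hintδ (hcont α) using 2
    rw [← mul_assoc, ← intervalIntegral.integral_const_mul]
    refine intervalIntegral.integral_congr_ae (Eventually.of_forall fun y hy => ?_)
    rw [uIoc_of_le zero_le_one] at hy
    rw [Real.rpow_add hy.1, Real.rpow_natCast]
    ring
  · subst hβ
    refine eventually_designLaw_Ksum_le hK hν hM hmeas hpos hprob hδ hintδ hγ hε ?_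
    convert tendsto_integral_div_Fnu_of_eq_neg_one hν hδ hintδ (hcont 0) using 2
    norm_num

end
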